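/- arXiv:1911.05982 — 2 statements merged into one kernel-verified Lean document; each statement's English description precedes it below -/
import Mathlib

section
/- The Wilson Morse function W is smooth on ℝⁿ, and it attains a global minimum on ℝⁿ at a unique point (x₁*, …, xₙ*). -/
/-- `g_a(θ) = (1/2)(arctan((θ+Im a)/Re a) + arctan((θ−Im a)/Re a))`. -/
noncomputable def gfun (a : ℂ) (θ : ℝ) : ℝ :=
  (Real.arctan ((θ + a.im) / a.re) + Real.arctan ((θ - a.im) / a.re)) / 2

/-- `G_a(s) = ∫₀ˢ g_a(θ) dθ`. -/
noncomputable def Gfun (a : ℂ) (s : ℝ) : ℝ := ∫ θ in (0:ℝ)..s, gfun a θ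

/-- `F(s) = ∫₀ˢ arctan(θ) dθ`. -/
noncomputable def Ffun (s : ℝ) : ℝ := ∫ θ in (0:ℝ)..s, Real.arctan θ

/-- The Wilson Morse function
`W(x) = Σ_{j<k} (F(x_j + x_k) + F(x_j − x_k))
        + Σ_j (G_a(x_j) + G_b(x_j) + G_c(x_j) + G_d(x_j) − π·j·x_j)`,
with `j, k` running through `1, …, n` (so a Lean index `j : Fin n` corresponds to `j+1`). -/
noncomputable def W (n : ℕ) (a b c d : ℂ) (x : Fin n → ℝ) : ℝ :=
  (∑ j : Fin n, ∑ k : Fin n, if j < k then Ffun (x j + x k) + Ffun (x j - x k) else 0)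
  + ∑ j : Fin n, (Gfun a (x j) + Gfun b (x j) + Gfun c (x j) + Gfun d (x j)
      - Real.pi * (((j : ℕ) : ℝ) + 1) * x j)

/-- Non-real parameters among `{a,b,c,d}` occur in complex-conjugate pairs, i.e. the
multiset `{a,b,c,d}` is invariant under complex conjugation. -/
def QuadCond (a b c d : ℂ) : Prop :=
  Multiset.map (starRingEnd ℂ) {a, b, c, d} = ({a, b, c, d} : Multiset ℂ)

theorem hasDerivAt_integral_zero {f : ℝ → ℝ} (hf : Continuous f) (s : ℝ) :
    HasDerivAt (fun s => ∫ θ in (0 : ℝ)..s, f θ) (f s) s :=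
  intervalIntegral.integral_hasDerivAt_right (hf.intervalIntegrable _ _)
    (hf.stronglyMeasurableAtFilter _ _) hf.continuousAt

theorem contDiff_integral_zero {f : ℝ → ℝ} (hf : ContDiff ℝ (⊤ : ℕ∞) f) :
    ContDiff ℝ (⊤ : ℕ∞) (fun s => ∫ θ in (0 : ℝ)..s, f θ) := by
  have h := hasDerivAt_integral_zero hf.continuous
  rw [contDiff_infty_iff_deriv]
  refine ⟨fun s => (h s).differentiableAt, ?_⟩
  rwa [show deriv (fun s => ∫ θ in (0 : ℝ)..s, f θ) = f from funext fun s => (h s).deriv]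

theorem strictConvexOn_integral_zero {f : ℝ → ℝ} (hf : Continuous f) (hm : StrictMono f) :
    StrictConvexOn ℝ Set.univ (fun s => ∫ θ in (0 : ℝ)..s, f θ) := by
  have h := hasDerivAt_integral_zero hf
  refine StrictMono.strictConvexOn_univ_of_deriv
    (continuous_iff_continuousAt.2 fun s => (h s).continuousAt) ?_
  rwa [show deriv (fun s => ∫ θ in (0 : ℝ)..s, f θ) = f from funext fun s => (h s).deriv]

/-- A function on `ℝ` whose derivative has a positive limit at `+∞` tends to `+∞` there. -/
theorem tendsto_atTop_of_hasDerivAt {f f' : ℝ → ℝ} {l : ℝ} (hl : 0 < l)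
    (hf : ∀ x, HasDerivAt f (f' x) x) (hlim : Filter.Tendsto f' Filter.atTop (nhds l)) :
    Filter.Tendsto f Filter.atTop Filter.atTop := by
  obtain ⟨M, hM⟩ := Filter.eventually_atTop.1 (hlim.eventually (lt_mem_nhds (half_lt_self hl)))
  have hlin : Filter.Tendsto (fun x => f M + l / 2 * (x - M)) Filter.atTop Filter.atTop :=
    Filter.tendsto_atTop_add_const_left _ _
      ((Filter.tendsto_atTop_add_const_right _ (-M) Filter.tendsto_id).const_mul_atTop (half_pos hl))
  refine Filter.tendsto_atTop_mono' _ ?_ hlin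
  filter_upwards [Filter.eventually_ge_atTop M] with x hx
  have := (convex_Ici M).mul_sub_le_image_sub_of_le_deriv
    (fun y _ => (hf y).continuousAt.continuousWithinAt)
    (fun y _ => (hf y).differentiableAt.differentiableWithinAt)
    (C := l / 2)
    (fun y hy => by
      rw [(hf y).deriv]
      exact (hM y (interior_subset hy)).le)
    M Set.self_mem_Ici x hx hx
  linarith

theorem tendsto_cocompact_of_hasDerivAt {f f' : ℝ → ℝ} {l m : ℝ} (hl : 0 < l) (hm : m < 0)
    (hf : ∀ x, HasDerivAt f (f' x) x) (htop : Filter.Tendsto f' Filter.atTop (nhds l))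
    (hbot : Filter.Tendsto f' Filter.atBot (nhds m)) :
    Filter.Tendsto f (Filter.cocompact ℝ) Filter.atTop := by
  rw [cocompact_eq_atBot_atTop, Filter.tendsto_sup]
  refine ⟨?_, tendsto_atTop_of_hasDerivAt hl hf htop⟩
  have h := tendsto_atTop_of_hasDerivAt (f := fun x => f (-x)) (f' := fun x => -f' (-x))
    (neg_pos.2 hm) (fun x => by
      simpa [Function.comp_def] using (hf (-x)).comp x (hasDerivAt_neg x))
    (hbot.comp Filter.tendsto_neg_atTop_atBot).neg
  simpa [Function.comp_def] using h.comp Filter.tendsto_neg_atBot_atTop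

/-- A separable sum of coercive continuous functions of one variable is coercive. -/
theorem tendsto_sum_cocompact {ι : Type*} [Fintype ι] {h : ι → ℝ → ℝ}
    (hcont : ∀ i, Continuous (h i))
    (hlim : ∀ i, Filter.Tendsto (h i) (Filter.cocompact ℝ) Filter.atTop) :
    Filter.Tendsto (fun x : ι → ℝ => ∑ i, h i (x i)) (Filter.cocompact (ι → ℝ)) Filter.atTop := by
  classical
  choose t ht using fun i => (hcont i).exists_forall_le (hlim i)
  rw [← Filter.coprodᵢ_cocompact, Filter.coprodᵢ, Filter.tendsto_iSup]
  intro i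
  refine Filter.tendsto_atTop_mono
    (f := fun x : ι → ℝ => h i (x i) + ∑ k ∈ Finset.univ.erase i, h k (t k)) (fun x => ?_)
    (Filter.tendsto_atTop_add_const_right _ _ ((hlim i).comp Filter.tendsto_comap))
  rw [← Finset.add_sum_erase _ _ (Finset.mem_univ i)]
  gcongr with k
  exact ht k (x k)

theorem strictConvexOn_sum_apply {ι : Type*} [Fintype ι] {h : ι → ℝ → ℝ}
    (hconv : ∀ i, StrictConvexOn ℝ Set.univ (h i)) :
    StrictConvexOn ℝ Set.univ (fun x : ι → ℝ => ∑ i, h i (x i)) := by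
  refine ⟨convex_univ, fun x _ y _ hxy p q hp hq hpq => ?_⟩
  obtain ⟨i, hi⟩ := Function.ne_iff.1 hxy
  simp only [smul_eq_mul, Finset.mul_sum, ← Finset.sum_add_distrib]
  refine Finset.sum_lt_sum (fun k _ => ?_) ⟨i, Finset.mem_univ i, ?_⟩
  · simpa using (hconv k).convexOn.2 (Set.mem_univ (x k)) (Set.mem_univ (y k)) hp.le hq.le hpq
  · simpa using (hconv i).2 (Set.mem_univ (x i)) (Set.mem_univ (y i)) hi hp hq hpq

theorem contDiff_gfun (a : ℂ) : ContDiff ℝ (⊤ : ℕ∞) (gfun a) := by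
  unfold gfun
  exact ((Real.contDiff_arctan.comp (by fun_prop)).add
    (Real.contDiff_arctan.comp (by fun_prop))).div_const 2

theorem strictMono_gfun {a : ℂ} (ha : 0 < a.re) : StrictMono (gfun a) := by
  intro x y hxy
  have h₁ : Real.arctan ((x + a.im) / a.re) < Real.arctan ((y + a.im) / a.re) :=
    Real.arctan_strictMono (by gcongr)
  have h₂ : Real.arctan ((x - a.im) / a.re) < Real.arctan ((y - a.im) / a.re) :=
    Real.arctan_strictMono (by gcongr)
  unfold gfun
  linarith

theorem tendsto_gfun_atTop {a : ℂ} (ha : 0 < a.re) :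
    Filter.Tendsto (gfun a) Filter.atTop (nhds (Real.pi / 2)) := by
  have hat := tendsto_nhds_of_tendsto_nhdsWithin Real.tendsto_arctan_atTop
  have h₁ := hat.comp ((Filter.tendsto_atTop_add_const_right _ a.im
    Filter.tendsto_id).atTop_div_const ha)
  have h₂ := hat.comp ((Filter.tendsto_atTop_add_const_right _ (-a.im)
    Filter.tendsto_id).atTop_div_const ha)
  have h := (h₁.add h₂).div_const 2
  rwa [add_self_div_two] at h

theorem tendsto_gfun_atBot {a : ℂ} (ha : 0 < a.re) :
    Filter.Tendsto (gfun a) Filter.atBot (nhds (-(Real.pi / 2))) := by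
  have hat := tendsto_nhds_of_tendsto_nhdsWithin Real.tendsto_arctan_atBot
  have h₁ := hat.comp ((Filter.tendsto_atBot_add_const_right _ a.im
    Filter.tendsto_id).atBot_div_const ha)
  have h₂ := hat.comp ((Filter.tendsto_atBot_add_const_right _ (-a.im)
    Filter.tendsto_id).atBot_div_const ha)
  have h := (h₁.add h₂).div_const 2
  rwa [add_self_div_two] at h

theorem hasDerivAt_Gfun (a : ℂ) (s : ℝ) : HasDerivAt (Gfun a) (gfun a s) s :=
  hasDerivAt_integral_zero (contDiff_gfun a).continuous s

theorem contDiff_Gfun (a : ℂ) : ContDiff ℝ (⊤ : ℕ∞) (Gfun a) :=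
  contDiff_integral_zero (contDiff_gfun a)

theorem strictConvexOn_Gfun {a : ℂ} (ha : 0 < a.re) : StrictConvexOn ℝ Set.univ (Gfun a) :=
  strictConvexOn_integral_zero (contDiff_gfun a).continuous (strictMono_gfun ha)

theorem hasDerivAt_Ffun (s : ℝ) : HasDerivAt Ffun (Real.arctan s) s :=
  hasDerivAt_integral_zero Real.continuous_arctan s

theorem contDiff_Ffun : ContDiff ℝ (⊤ : ℕ∞) Ffun :=
  contDiff_integral_zero Real.contDiff_arctan

theorem convexOn_Ffun : ConvexOn ℝ Set.univ Ffun :=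
  (strictConvexOn_integral_zero Real.continuous_arctan Real.arctan_strictMono).convexOn

theorem Ffun_neg (s : ℝ) : Ffun (-s) = Ffun s := by
  have h := intervalIntegral.integral_comp_neg (a := 0) (b := s) Real.arctan
  simp only [Real.arctan_neg, intervalIntegral.integral_neg, neg_zero] at h
  rw [Ffun, Ffun, intervalIntegral.integral_symm, ← h, neg_neg]

theorem two_mul_Ffun_le (u v : ℝ) : 2 * Ffun v ≤ Ffun (u + v) + Ffun (u - v) := by
  have h := convexOn_Ffun.2 (Set.mem_univ (u + v)) (Set.mem_univ (v - u))
    (show (0 : ℝ) ≤ 1 / 2 by norm_num) (show (0 : ℝ) ≤ 1 / 2 by norm_num) (by norm_num)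
  simp only [smul_eq_mul] at h
  rw [show 1 / 2 * (u + v) + 1 / 2 * (v - u) = v by ring, ← neg_sub u v, Ffun_neg] at h
  linarith

/-- The one-variable summand of the separable lower bound for `W`. -/
noncomputable def wilsonBound (a b c d : ℂ) (m : ℕ) (t : ℝ) : ℝ :=
  m * (2 * Ffun t) + (Gfun a t + Gfun b t + Gfun c t + Gfun d t - Real.pi * ((m : ℝ) + 1) * t)

theorem hasDerivAt_wilsonBound (a b c d : ℂ) (m : ℕ) (t : ℝ) :
    HasDerivAt (wilsonBound a b c d m) (m * (2 * Real.arctan t) +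
      (gfun a t + gfun b t + gfun c t + gfun d t - Real.pi * ((m : ℝ) + 1))) t := by
  have h := (((hasDerivAt_Ffun t).const_mul 2).const_mul (m : ℝ)).add
    (((((hasDerivAt_Gfun a t).add (hasDerivAt_Gfun b t)).add (hasDerivAt_Gfun c t)).add
      (hasDerivAt_Gfun d t)).sub ((hasDerivAt_id t).const_mul (Real.pi * ((m : ℝ) + 1))))
  rw [mul_one] at h
  exact h

theorem tendsto_wilsonBound {a b c d : ℂ}
    (ha : 0 < a.re) (hb : 0 < b.re) (hc : 0 < c.re) (hd : 0 < d.re) (m : ℕ) :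
    Filter.Tendsto (wilsonBound a b c d m) (Filter.cocompact ℝ) Filter.atTop := by
  have hπ := Real.pi_pos
  have hmπ : 0 ≤ m * Real.pi := by positivity
  refine tendsto_cocompact_of_hasDerivAt ?_ ?_ (hasDerivAt_wilsonBound a b c d m)
    ((((tendsto_nhds_of_tendsto_nhdsWithin Real.tendsto_arctan_atTop).const_mul 2).const_mul
      (m : ℝ)).add (((((tendsto_gfun_atTop ha).add (tendsto_gfun_atTop hb)).add
        (tendsto_gfun_atTop hc)).add (tendsto_gfun_atTop hd)).sub_const _))
    ((((tendsto_nhds_of_tendsto_nhdsWithin Real.tendsto_arctan_atBot).const_mul 2).const_mul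
      (m : ℝ)).add (((((tendsto_gfun_atBot ha).add (tendsto_gfun_atBot hb)).add
        (tendsto_gfun_atBot hc)).add (tendsto_gfun_atBot hd)).sub_const _))
  · linarith
  · linarith

theorem sum_wilsonBound_le_W (n : ℕ) (a b c d : ℂ) (x : Fin n → ℝ) :
    ∑ k : Fin n, wilsonBound a b c d k (x k) ≤ W n a b c d x := by
  simp only [wilsonBound, W, Finset.sum_add_distrib (f := fun k : Fin n => _ * (2 * Ffun (x k)))]
  refine add_le_add_left ?_ _
  rw [Finset.sum_comm]
  refine Finset.sum_le_sum fun k _ => ?_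
  calc ((k : ℕ) : ℝ) * (2 * Ffun (x k))
      = ∑ j : Fin n, if j < k then 2 * Ffun (x k) else 0 := by
        rw [← Finset.sum_filter, Finset.sum_const, nsmul_eq_mul, Finset.filter_gt_eq_Iio,
          Fin.card_Iio]
    _ ≤ _ := Finset.sum_le_sum fun j _ => by
        split_ifs
        · exact two_mul_Ffun_le _ _
        · exact le_rfl

theorem contDiff_W (n : ℕ) (a b c d : ℂ) : ContDiff ℝ (⊤ : ℕ∞) (W n a b c d) := by
  have hF := contDiff_Ffun
  have hG := contDiff_Gfun
  refine .add (.sum fun j _ => .sum fun k _ => ?_) (.sum fun j _ => ?_)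
  · split_ifs
    · exact (hF.comp (by fun_prop)).add (hF.comp (by fun_prop))
    · exact contDiff_const
  · exact (((((hG a).comp (by fun_prop)).add ((hG b).comp (by fun_prop))).add
      ((hG c).comp (by fun_prop))).add ((hG d).comp (by fun_prop))).sub (by fun_prop)

theorem strictConvexOn_W {n : ℕ} {a b c d : ℂ}
    (ha : 0 < a.re) (hb : 0 < b.re) (hc : 0 < c.re) (hd : 0 < d.re) :
    StrictConvexOn ℝ Set.univ (W n a b c d) := by
  refine ConvexOn.add_strictConvexOn ?_ (strictConvexOn_sum_apply
    (h := fun (j : Fin n) t => Gfun a t + Gfun b t + Gfun c t + Gfun d t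
      - Real.pi * (((j : ℕ) : ℝ) + 1) * t) fun j => ?_)
  · refine ⟨convex_univ, fun x _ y _ p q hp hq hpq => ?_⟩
    simp only [smul_eq_mul, Finset.mul_sum, ← Finset.sum_add_distrib]
    refine Finset.sum_le_sum fun j _ => Finset.sum_le_sum fun k _ => ?_
    split_ifs
    · have h₁ := convexOn_Ffun.2 (Set.mem_univ (x j + x k)) (Set.mem_univ (y j + y k)) hp hq hpq
      have h₂ := convexOn_Ffun.2 (Set.mem_univ (x j - x k)) (Set.mem_univ (y j - y k)) hp hq hpq
      simp only [smul_eq_mul, Pi.add_apply, Pi.smul_apply] at h₁ h₂ ⊢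
      rw [show p * x j + q * y j + (p * x k + q * y k) = p * (x j + x k) + q * (y j + y k) by ring,
        show p * x j + q * y j - (p * x k + q * y k) = p * (x j - x k) + q * (y j - y k) by ring]
      linarith
    · simp
  · exact ((((strictConvexOn_Gfun ha).add (strictConvexOn_Gfun hb)).add
      (strictConvexOn_Gfun hc)).add (strictConvexOn_Gfun hd)).sub_concaveOn
        ((LinearMap.mul ℝ ℝ (Real.pi * (((j : ℕ) : ℝ) + 1))).concaveOn convex_univ)

theorem tendsto_W_cocompact {n : ℕ} {a b c d : ℂ}
    (ha : 0 < a.re) (hb : 0 < b.re) (hc : 0 < c.re) (hd : 0 < d.re) :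
    Filter.Tendsto (W n a b c d) (Filter.cocompact (Fin n → ℝ)) Filter.atTop :=
  Filter.tendsto_atTop_mono (sum_wilsonBound_le_W n a b c d)
    (tendsto_sum_cocompact
      (fun k => continuous_iff_continuousAt.2 fun t =>
        (hasDerivAt_wilsonBound a b c d k t).continuousAt)
      fun k => tendsto_wilsonBound ha hb hc hd k)

/-- the Wilson Morse function `W` is smooth on `ℝⁿ` and attains a global
minimum on `ℝⁿ` at a unique point. -/
theorem wilson_morse_smooth_and_unique_min
    (n : ℕ) (hn : 1 ≤ n) (a b c d : ℂ)
    (ha : 0 < a.re) (hb : 0 < b.re) (hc : 0 < c.re) (hd : 0 < d.re)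
    (habcd : QuadCond a b c d) :
    ContDiff ℝ (⊤ : ℕ∞) (W n a b c d) ∧
    ∃! xs : Fin n → ℝ, ∀ y : Fin n → ℝ, W n a b c d xs ≤ W n a b c d y := by
  have hsm := contDiff_W n a b c d
  obtain ⟨xs, hxs⟩ := hsm.continuous.exists_forall_le (tendsto_W_cocompact ha hb hc hd)
  refine ⟨hsm, xs, hxs, fun y hy => ?_⟩
  exact (strictConvexOn_W ha hb hc hd).eq_of_isMinOn (fun z _ => hy z) (fun z _ => hxs z)
    (Set.mem_univ y) (Set.mem_univ xs)
end

section
/- The Wilson Morse function W is radially unbounded (coercive): W(x₁,…,xₙ) → +∞ as x₁² + ⋯ + xₙ² → +∞. -/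
/-- The primitive of an odd continuous function with limit above `L` at `+∞` grows at least like
`L * |s|`, up to an additive constant. -/
theorem exists_forall_le_integral_of_odd {f : ℝ → ℝ} (hf : Continuous f)
    (hodd : ∀ θ, f (-θ) = -f θ) {l L : ℝ} (hlim : Filter.Tendsto f Filter.atTop (nhds l))
    (hL : L < l) : ∃ C : ℝ, ∀ s : ℝ, L * |s| - C ≤ ∫ θ in (0:ℝ)..s, f θ := by
  obtain ⟨T, hT⟩ := Filter.eventually_atTop.1 (hlim.eventually (lt_mem_nhds hL))
  have hint : ∀ u v : ℝ, IntervalIntegrable f MeasureTheory.volume u v :=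
    fun u v => hf.intervalIntegrable u v
  have hcont : Continuous fun s : ℝ => (∫ θ in (0:ℝ)..s, f θ) - L * s :=
    (intervalIntegral.continuous_primitive hint 0).sub (continuous_const.mul continuous_id)
  obtain ⟨m, hm⟩ := (isCompact_Icc (a := (0:ℝ)) (b := max T 0)).bddBelow_image hcont.continuousOn
  have hle : ∀ s ∈ Set.Icc (0:ℝ) (max T 0), m ≤ (∫ θ in (0:ℝ)..s, f θ) - L * s :=
    fun s hs => hm (Set.mem_image_of_mem _ hs)
  have hpos : ∀ s : ℝ, 0 ≤ s → L * s + m ≤ ∫ θ in (0:ℝ)..s, f θ := by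
    intro s hs
    rcases le_total s (max T 0) with h | h
    · linarith [hle s ⟨hs, h⟩]
    · have h1 := hle (max T 0) ⟨le_max_right _ _, le_rfl⟩
      have h2 := intervalIntegral.integral_add_adjacent_intervals
        (hint 0 (max T 0)) (hint (max T 0) s)
      have h3 : (∫ _ in (max T 0)..s, L) ≤ ∫ θ in (max T 0)..s, f θ :=
        intervalIntegral.integral_mono_on h (by simp) (hint _ _)
          fun θ hθ => (hT θ ((le_max_left _ _).trans hθ.1)).le
      rw [intervalIntegral.integral_const, smul_eq_mul] at h3
      linarith
  have heven : ∀ s : ℝ, (∫ θ in (0:ℝ)..(-s), f θ) = ∫ θ in (0:ℝ)..s, f θ := by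
    intro s
    have h := intervalIntegral.integral_comp_neg (a := 0) (b := s) f
    simp only [hodd, intervalIntegral.integral_neg, neg_zero] at h
    rw [intervalIntegral.integral_symm, ← h, neg_neg]
  refine ⟨-m, fun s => ?_⟩
  rcases le_total 0 s with h | h
  · rw [abs_of_nonneg h]
    linarith [hpos s h]
  · rw [abs_of_nonpos h, ← heven s]
    linarith [hpos (-s) (by linarith)]

theorem exists_forall_le_Ffun {L : ℝ} (hL : L < Real.pi / 2) :
    ∃ C : ℝ, ∀ s : ℝ, L * |s| - C ≤ Ffun s :=
  exists_forall_le_integral_of_odd Real.continuous_arctan Real.arctan_neg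
    (Real.tendsto_arctan_atTop.mono_right nhdsWithin_le_nhds) hL

theorem gfun_neg (a : ℂ) (θ : ℝ) : gfun a (-θ) = -gfun a θ := by
  unfold gfun
  rw [show (-θ + a.im) / a.re = -((θ - a.im) / a.re) by ring,
    show (-θ - a.im) / a.re = -((θ + a.im) / a.re) by ring, Real.arctan_neg, Real.arctan_neg]
  ring

theorem continuous_gfun (a : ℂ) : Continuous (gfun a) := by
  unfold gfun
  fun_prop

theorem exists_forall_le_Gfun {a : ℂ} (ha : 0 < a.re) {L : ℝ} (hL : L < Real.pi / 2) :
    ∃ C : ℝ, ∀ s : ℝ, L * |s| - C ≤ Gfun a s :=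
  exists_forall_le_integral_of_odd (continuous_gfun a) (gfun_neg a) (tendsto_gfun_atTop ha) hL

theorem two_mul_abs_le_abs_add_add_abs_sub (u v : ℝ) : 2 * |v| ≤ |u + v| + |u - v| := by
  have h := abs_sub (u + v) (u - v)
  rwa [show u + v - (u - v) = 2 * v by ring, abs_mul, abs_two] at h

theorem sum_sum_ite_lt {n : ℕ} (f : Fin n → ℝ) :
    (∑ j : Fin n, ∑ k : Fin n, if j < k then f k else 0) = ∑ k : Fin n, ((k : ℕ) : ℝ) * f k := by
  rw [Finset.sum_comm]
  refine Finset.sum_congr rfl fun k _ => ?_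
  rw [← Finset.sum_filter, Finset.sum_const, nsmul_eq_mul, Finset.filter_gt_eq_Iio, Fin.card_Iio]

/-- The Wilson Morse function grows at least linearly. -/
theorem exists_forall_le_W (n : ℕ) {a b c d : ℂ}
    (ha : 0 < a.re) (hb : 0 < b.re) (hc : 0 < c.re) (hd : 0 < d.re) :
    ∃ C : ℝ, ∀ x : Fin n → ℝ, Real.pi / 2 * ∑ j : Fin n, |x j| - C ≤ W n a b c d x := by
  have hpi := Real.pi_pos
  have hn : (0:ℝ) < n + 1 := by positivity
  set ε : ℝ := Real.pi / (4 * (n + 1)) with hε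
  have hε_pos : 0 < ε := by positivity
  have hε_mul : ε * (n + 1) = Real.pi / 4 := by rw [hε]; field_simp
  set L : ℝ := Real.pi / 2 - ε with hLdef
  have hL : L < Real.pi / 2 := by linarith
  have hL0 : 0 ≤ L := by nlinarith [(Nat.cast_nonneg n : (0:ℝ) ≤ n)]
  obtain ⟨CF, hF⟩ := exists_forall_le_Ffun hL
  obtain ⟨Ca, hGa⟩ := exists_forall_le_Gfun ha hL
  obtain ⟨Cb, hGb⟩ := exists_forall_le_Gfun hb hL
  obtain ⟨Cc, hGc⟩ := exists_forall_le_Gfun hc hL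
  obtain ⟨Cd, hGd⟩ := exists_forall_le_Gfun hd hL
  refine ⟨∑ k : Fin n, (((k : ℕ) : ℝ) * (2 * CF) + (Ca + Cb + Cc + Cd)), fun x => ?_⟩
  have hpair : (∑ k : Fin n, ((k : ℕ) : ℝ) * (2 * L * |x k| - 2 * CF)) ≤
      ∑ j : Fin n, ∑ k : Fin n, if j < k then Ffun (x j + x k) + Ffun (x j - x k) else 0 := by
    rw [← sum_sum_ite_lt fun k => 2 * L * |x k| - 2 * CF]
    refine Finset.sum_le_sum fun j _ => Finset.sum_le_sum fun k _ => ?_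
    split_ifs
    · have := mul_le_mul_of_nonneg_left (two_mul_abs_le_abs_add_add_abs_sub (x j) (x k)) hL0
      linarith [hF (x j + x k), hF (x j - x k)]
    · exact le_rfl
  unfold W
  refine le_trans ?_ (add_le_add_left hpair _)
  rw [Finset.mul_sum, ← Finset.sum_sub_distrib, ← Finset.sum_add_distrib]
  refine Finset.sum_le_sum fun k _ => ?_
  have hk : ((k : ℕ) : ℝ) + 1 ≤ n := by exact_mod_cast k.isLt
  have hk0 : (0:ℝ) ≤ ((k : ℕ) : ℝ) := Nat.cast_nonneg _
  have hlin : Real.pi * (((k : ℕ) : ℝ) + 1) * x k ≤ Real.pi * (((k : ℕ) : ℝ) + 1) * |x k| :=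
    mul_le_mul_of_nonneg_left (le_abs_self _) (by positivity)
  have hcoef : Real.pi / 2 ≤
      ((k : ℕ) : ℝ) * (2 * L) + 4 * L - Real.pi * (((k : ℕ) : ℝ) + 1) := by
    have : ε * (((k : ℕ) : ℝ) + 2) ≤ ε * (n + 1) :=
      mul_le_mul_of_nonneg_left (by linarith) hε_pos.le
    rw [hLdef]
    linarith
  have := mul_le_mul_of_nonneg_right hcoef (abs_nonneg (x k))
  linarith [hGa (x k), hGb (x k), hGc (x k), hGd (x k)]

/-- the Wilson Morse function `W` is radially unbounded (coercive):
`W(x) → +∞` as `x₁² + ⋯ + xₙ² → +∞`. -/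
theorem wilson_morse_radially_unbounded
    (n : ℕ) (hn : 1 ≤ n) (a b c d : ℂ)
    (ha : 0 < a.re) (hb : 0 < b.re) (hc : 0 < c.re) (hd : 0 < d.re)
    (habcd : QuadCond a b c d) :
    ∀ M : ℝ, ∃ R : ℝ, ∀ x : Fin n → ℝ, R ≤ ∑ j : Fin n, (x j) ^ 2 → M ≤ W n a b c d x := by
  obtain ⟨C, hC⟩ := exists_forall_le_W n ha hb hc hd
  intro M
  refine ⟨(2 / Real.pi * (|M| + |C|)) ^ 2, fun x hx => le_trans ?_ (hC x)⟩
  have hpi := Real.pi_pos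
  have hsq : ∑ j : Fin n, x j ^ 2 ≤ (∑ j : Fin n, |x j|) ^ 2 := by
    simpa only [sq_abs] using
      Finset.sum_sq_le_sq_sum_of_nonneg (s := Finset.univ) fun j _ => abs_nonneg (x j)
  have hle : 2 / Real.pi * (|M| + |C|) ≤ ∑ j : Fin n, |x j| :=
    le_of_sq_le_sq (hx.trans hsq) (Finset.sum_nonneg fun j _ => abs_nonneg (x j))
  have h := mul_le_mul_of_nonneg_left hle (by positivity : 0 ≤ Real.pi / 2)
  rw [show Real.pi / 2 * (2 / Real.pi * (|M| + |C|)) = |M| + |C| by field_simp] at h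
  linarith [le_abs_self M, le_abs_self C]
end
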